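/- For all g ≥ 1 and all k, ℓ ≥ 1, if ξ ∈ h_{g,1}(k) and η ∈ h_{g,1}(ℓ) both lie in the kernel of the Enomoto–Satoh map (i.e. K_{12}(ξ) lies in the span of { v − σ_k·v : v ∈ H^{⊗k} } and K_{12}(η) lies in the span of { v − σ_ℓ·v : v ∈ H^{⊗ℓ} }), then the bracket [ξ,η] ∈ H^{⊗(k+ℓ+2)} also lies in the kernel of the Enomoto–Satoh map: K_{12}([ξ,η]) lies in the span of { v − σ_{k+ℓ}·v : v ∈ H^{⊗(k+ℓ)} }. -/

import Mathlib

noncomputable section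

open Finset

/-! ## The symplectic vector space `H = ℚ^{2g}` and its tensor powers -/

/-- `H_g = ℚ^{2g}`, with symplectic basis `x_1, y_1, …, x_g, y_g`
(`x_i` at index `2(i-1)`, `y_i` at index `2(i-1)+1`). -/
abbrev HH (g : ℕ) := Fin (2*g) → ℚ

/-- The tensor power `H^{⊗m}`, modelled as coefficient functions on words in the basis. -/
abbrev Tens (g m : ℕ) := (Fin m → Fin (2*g)) → ℚ

/-- index of `x_i` -/
def xI {g : ℕ} (i : Fin g) : Fin (2*g) := ⟨2*i.val, by have := i.isLt; omega⟩
/-- index of `y_i` -/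
def yI {g : ℕ} (i : Fin g) : Fin (2*g) := ⟨2*i.val+1, by have := i.isLt; omega⟩

/-- standard basis vectors of `HH g` -/
def stdB (g : ℕ) (a : Fin (2*g)) : HH g := fun b => if b = a then 1 else 0

/-- the symplectic form `ω` on `HH g` -/
def omegaF {g : ℕ} (u v : HH g) : ℚ :=
  ∑ i : Fin g, (u (xI i) * v (yI i) - u (yI i) * v (xI i))

/-- `ω(e_a , e_b)` on basis vectors -/
def omegaB (g : ℕ) (a b : Fin (2*g)) : ℚ := omegaF (stdB g a) (stdB g b)

/-- the pure tensor `u ⊗ ξ` -/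
def oneTmul {g m : ℕ} (u : HH g) (ξ : Tens g m) : Tens g (m+1) :=
  fun w => u (w 0) * ξ (fun i => w i.succ)

/-- the bracket `[u, ξ] = u ⊗ ξ - ξ ⊗ u` in the tensor algebra -/
def oneBrkt {g m : ℕ} (u : HH g) (ξ : Tens g m) : Tens g (m+1) :=
  fun w => u (w 0) * ξ (fun i => w i.succ)
    - ξ (fun i => w i.castSucc) * u (w (Fin.last m))

/-- left-normed Lie bracket `[u 0, [u 1, [… , u m]…]]` -/
def leftNormed (g : ℕ) : (m : ℕ) → (Fin (m+1) → HH g) → Tens g (m+1)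
  | 0, u => fun w => u 0 (w 0)
  | (m+1), u => oneBrkt (u 0) (leftNormed g m (fun i => u i.succ))

/-- `L_{g,1}(m+1)`: the degree `m+1` part of the free Lie algebra on `HH g`,
i.e. the span of the left-normed brackets, inside `H^{⊗(m+1)}`. -/
def Lsub (g m : ℕ) : Submodule ℚ (Tens g (m+1)) :=
  Submodule.span ℚ (Set.range (leftNormed g m))

/-- the linear extension of `u ⊗ ξ ↦ u ⊗ ξ - ξ ⊗ u` to all of `H^{⊗(m+1)}` -/
def betaFun {g m : ℕ} (t : Tens g (m+1)) : Tens g (m+1) :=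
  fun w => t w - t (fun i => Fin.cases (w (Fin.last m)) (fun j => w j.castSucc) i)

/-- `betaFun` as a linear map -/
def betaL (g m : ℕ) : Tens g (m+1) →ₗ[ℚ] Tens g (m+1) where
  toFun := betaFun
  map_add' a b := by funext w; simp only [betaFun, Pi.add_apply]; ring
  map_smul' c a := by
    funext w
    simp only [betaFun, Pi.smul_apply, smul_eq_mul, RingHom.id_apply]
    ring

/-- `H ⊗ L_{g,1}(k+1)` inside `H^{⊗(k+2)}` -/
def HLsub (g k : ℕ) : Submodule ℚ (Tens g (k+2)) :=
  Submodule.span ℚ {t | ∃ (u : HH g) (ξ : Tens g (k+1)), ξ ∈ Lsub g k ∧ t = oneTmul u ξ}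

/-- `h_{g,1}(k) = Ker ([·,·] : H ⊗ L_{g,1}(k+1) → L_{g,1}(k+2))`,
as a subspace of `H^{⊗(k+2)}`. -/
def hgl (g k : ℕ) : Submodule ℚ (Tens g (k+2)) :=
  HLsub g k ⊓ LinearMap.ker (betaL g (k+1))

/-- the symplectic group `Sp(2g,ℚ)`: linear automorphisms preserving `ω` -/
def SpSet (g : ℕ) : Set (HH g ≃ₗ[ℚ] HH g) :=
  {f | ∀ u v : HH g, omegaF (f u) (f v) = omegaF u v}

/-- the diagonal action of a map `f : H → H` on `H^{⊗m}` -/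
def tensMapF {g m : ℕ} (f : HH g → HH g) (t : Tens g m) : Tens g m :=
  fun w' => ∑ w : Fin m → Fin (2*g), t w * ∏ i, f (stdB g (w i)) (w' i)

/-- the subspace of `Sp(2g,ℚ)`-invariant tensors in `H^{⊗m}` -/
def spInv (g m : ℕ) : Submodule ℚ (Tens g m) where
  carrier := {t | ∀ f : HH g ≃ₗ[ℚ] HH g, f ∈ SpSet g → tensMapF (⇑f) t = t}
  add_mem' := by
    intro a b ha hb f hf
    have h : tensMapF (⇑f) (a + b) = tensMapF (⇑f) a + tensMapF (⇑f) b := by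
      funext w'
      simp only [tensMapF, Pi.add_apply, add_mul]
      rw [Finset.sum_add_distrib]
    rw [Set.mem_setOf_eq] at *
    rw [h, ha f hf, hb f hf]
  zero_mem' := by
    intro f hf
    funext w'
    simp [tensMapF]
  smul_mem' := by
    intro c a ha f hf
    have h : tensMapF (⇑f) (c • a) = c • tensMapF (⇑f) a := by
      funext w'
      simp only [tensMapF, Pi.smul_apply, smul_eq_mul, Finset.mul_sum]
      exact Finset.sum_congr rfl fun w _ => by ring
    rw [h, ha f hf]

/-- the `Sp`-invariant part `h_{g,1}(k)^{Sp}` -/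
def hSp (g k : ℕ) : Submodule ℚ (Tens g (k+2)) := hgl g k ⊓ spInv g (k+2)

/-- the symmetric bilinear form `μ^{⊗m}` on `H^{⊗m}` -/
def muF {g m : ℕ} (ξ η : Tens g m) : ℚ :=
  ∑ w : Fin m → Fin (2*g), ∑ w' : Fin m → Fin (2*g),
    ξ w * η w' * ∏ i, omegaB g (w i) (w' i)

/-! ## The Enomoto–Satoh contraction and cyclic coinvariants -/

/-- the contraction `K_{12} : H^{⊗(m+2)} → H^{⊗m}`,
`u_1 ⊗ u_2 ⊗ u_3 ⊗ ⋯ ↦ ω(u_1,u_2) · u_3 ⊗ ⋯` -/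
def K12 {g m : ℕ} (t : Tens g (m+2)) : Tens g m :=
  fun w => ∑ a : Fin (2*g), ∑ b : Fin (2*g), omegaB g a b * t (Fin.cons a (Fin.cons b w))

/-- the cyclic permutation acting on `H^{⊗m}` -/
def cycT {g m : ℕ} (t : Tens g m) : Tens g m := fun w => t (fun i => w (finRotate m i))

/-- the span of `{ v - σ_m · v }`, i.e. the kernel of the projection to the
cyclic coinvariants `(H^{⊗m})_{ℤ/m}` -/
def cycSpan (g m : ℕ) : Submodule ℚ (Tens g m) :=
  Submodule.span ℚ {t | ∃ v : Tens g m, t = v - cycT v}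

/-- the bracket `[ξ,η] ∈ H^{⊗(k+l+2)}` of `ξ ∈ H^{⊗(k+2)}` and `η ∈ H^{⊗(l+2)}`,
extending the Lie bracket of the symplectic derivation Lie algebra -/
def brT {g k l : ℕ} (ξ : Tens g (k+2)) (η : Tens g (l+2)) : Tens g (k+l+2) :=
  fun w =>
    (∑ p : Fin (k+2), if p.val = 0 then 0 else
      ∑ a : Fin (2*g), ∑ b : Fin (2*g), omegaB g a b *
        ξ (fun q : Fin (k+2) =>
            if q.val < p.val then w ⟨q.val, by have := q.isLt; omega⟩
            else if q.val = p.val then a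
            else w ⟨q.val + l, by have := q.isLt; omega⟩) *
        η (fun r : Fin (l+2) =>
            if r.val = 0 then b
            else w ⟨p.val + r.val - 1, by have := p.isLt; have := r.isLt; omega⟩))
    -
    (∑ p : Fin (l+2), if p.val = 0 then 0 else
      ∑ a : Fin (2*g), ∑ b : Fin (2*g), omegaB g b a *
        η (fun r : Fin (l+2) =>
            if r.val < p.val then w ⟨r.val, by have := r.isLt; omega⟩
            else if r.val = p.val then b
            else w ⟨r.val + k, by have := r.isLt; omega⟩) *
        ξ (fun q : Fin (k+2) =>
            if q.val = 0 then a
            else w ⟨p.val + q.val - 1, by have := p.isLt; have := q.isLt; omega⟩))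

/-! ## Rotations and cyclic coinvariants -/

/-- rotation of the tensor factors by `j` places -/
def rotT {g n : ℕ} (j : ℕ) (t : Tens g n) : Tens g n :=
  fun w => t fun i => w ⟨(i.val + j) % n, Nat.mod_lt _ (by have := i.isLt; omega)⟩

theorem finRotate_val {n : ℕ} (i : Fin n) : (finRotate n i).val = (i.val + 1) % n := by
  cases n with
  | zero => exact i.elim0
  | succ n => simp [finRotate_apply, Fin.val_add]

theorem cycT_eq_rotT {g n : ℕ} (t : Tens g n) : cycT t = rotT 1 t := by
  funext w
  refine congrArg t (funext fun i => congrArg w (Fin.ext ?_))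
  exact finRotate_val i

theorem rotT_zero {g n : ℕ} (t : Tens g n) : rotT 0 t = t := by
  funext w
  refine congrArg t (funext fun i => congrArg w (Fin.ext ?_))
  simpa using Nat.mod_eq_of_lt i.isLt

theorem cycT_rotT {g n : ℕ} (j : ℕ) (t : Tens g n) : cycT (rotT j t) = rotT (j + 1) t := by
  rw [cycT_eq_rotT]
  funext w
  refine congrArg t (funext fun i => congrArg w (Fin.ext ?_))
  simp [add_assoc]

theorem sub_rotT_mem_cycSpan {g n : ℕ} (j : ℕ) (t : Tens g n) : t - rotT j t ∈ cycSpan g n := by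
  induction j with
  | zero => simp [rotT_zero]
  | succ j ih =>
    have h := (cycSpan g n).add_mem ih (Submodule.subset_span ⟨rotT j t, rfl⟩)
    rwa [cycT_rotT, sub_add_sub_cancel] at h

theorem omegaB_swap (g : ℕ) (a b : Fin (2 * g)) : omegaB g b a = -omegaB g a b := by
  simp only [omegaB, omegaF, ← Finset.sum_neg_distrib]
  exact Finset.sum_congr rfl fun _ _ => by ring

/-! ## Contracting a factor of one tensor with the first factor of another -/

/-- The contraction of the `p`-th factor of `t` with the first factor of `η`, the other factors
of `η` being inserted at the place `p`. -/
def substT {g n k l : ℕ} (h : n = k + l) (η : Tens g (l + 2)) (p : Fin k) (t : Tens g k) :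
    Tens g n :=
  fun w => ∑ a : Fin (2 * g), ∑ b : Fin (2 * g), omegaB g a b *
    t (fun q => if q.val < p.val then w ⟨q.val, by have := q.isLt; omega⟩
      else if q.val = p.val then a
      else w ⟨q.val + l, by have := q.isLt; omega⟩) *
    η (fun r => if r.val = 0 then b
      else w ⟨p.val + r.val - 1, by have := p.isLt; have := r.isLt; omega⟩)

/-- The derivation determined by `η`, acting on `H^{⊗k}`. -/
def derT {g n k l : ℕ} (h : n = k + l) (η : Tens g (l + 2)) : Tens g k →ₗ[ℚ] Tens g n where
  toFun t := ∑ p : Fin k, substT h η p t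
  map_add' s t := by
    rw [← Finset.sum_add_distrib]
    refine Finset.sum_congr rfl fun p _ => ?_
    funext w
    simp only [substT, Pi.add_apply, mul_add, add_mul, Finset.sum_add_distrib]
  map_smul' c t := by
    rw [Finset.smul_sum]
    refine Finset.sum_congr rfl fun p _ => ?_
    funext w
    simp only [substT, Pi.smul_apply, smul_eq_mul, RingHom.id_apply, Finset.mul_sum]
    exact Finset.sum_congr rfl fun _ _ => Finset.sum_congr rfl fun _ _ => by ring

theorem derT_apply {g n k l : ℕ} (h : n = k + l) (η : Tens g (l + 2)) (t : Tens g k) :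
    derT h η t = ∑ p : Fin k, substT h η p t := rfl

theorem substT_succ_cycT {g n k l : ℕ} (h : n = k + 1 + l) (η : Tens g (l + 2)) (p : Fin k)
    (t : Tens g (k + 1)) :
    substT h η p.succ (cycT t) = rotT 1 (substT h η p.castSucc t) := by
  rw [cycT_eq_rotT]
  funext w
  have hp := p.isLt
  refine Finset.sum_congr rfl fun a _ => Finset.sum_congr rfl fun b _ => ?_
  congr 1
  · congr 1
    refine congrArg t ?_
    funext q
    have hq := q.isLt
    by_cases hqk : q.val = k
    · have e1 : (q.val + 1) % (k + 1) = 0 := by rw [hqk]; exact Nat.mod_self _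
      have e2 : (q.val + l + 1) % n = 0 := by
        rw [show q.val + l + 1 = n by omega]; exact Nat.mod_self _
      have h1 : ¬ q.val < p.val := by omega
      have h2 : ¬ q.val = p.val := by omega
      simp [e1, e2, h1, h2]
    · have e1 : (q.val + 1) % (k + 1) = q.val + 1 := Nat.mod_eq_of_lt (by omega)
      have e2 : (q.val + l + 1) % n = q.val + 1 + l := by
        rw [Nat.mod_eq_of_lt (by omega)]; omega
      have e3 : (q.val + 1) % n = q.val + 1 := Nat.mod_eq_of_lt (by omega)
      simp [e1, e2, e3]
  · congr 1
    funext r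
    have hr := r.isLt
    by_cases hr0 : r.val = 0
    · simp [hr0]
    · have e : (p.val + r.val - 1 + 1) % n = p.val + 1 + r.val - 1 := by
        rw [Nat.mod_eq_of_lt (by omega)]; omega
      simp [hr0, e]

theorem substT_zero_cycT {g n k l : ℕ} (h : n = k + 1 + l) (η : Tens g (l + 2))
    (t : Tens g (k + 1)) :
    substT h η 0 (cycT t) = rotT (l + 1) (substT h η (Fin.last k) t) := by
  rw [cycT_eq_rotT]
  funext w
  refine Finset.sum_congr rfl fun a _ => Finset.sum_congr rfl fun b _ => ?_
  congr 1
  · congr 1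
    refine congrArg t ?_
    funext q
    have hq := q.isLt
    by_cases hqk : q.val = k
    · simp [hqk]
    · have e1 : (q.val + 1) % (k + 1) = q.val + 1 := Nat.mod_eq_of_lt (by omega)
      have e2 : (q.val + (l + 1)) % n = q.val + 1 + l := by
        rw [Nat.mod_eq_of_lt (by omega)]; omega
      have h1 : q.val < k := by omega
      simp [e1, e2, h1]
  · congr 1
    funext r
    have hr := r.isLt
    by_cases hr0 : r.val = 0
    · simp [hr0]
    · have e : (k + r.val - 1 + (l + 1)) % n = r.val - 1 := by
        rw [show k + r.val - 1 + (l + 1) = r.val - 1 + n by omega, Nat.add_mod_right]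
        exact Nat.mod_eq_of_lt (by omega)
      simp [hr0, e]

theorem derT_sub_cycT_mem {g n k l : ℕ} (h : n = k + l) (η : Tens g (l + 2)) (t : Tens g k) :
    derT h η (t - cycT t) ∈ cycSpan g n := by
  cases k with
  | zero => simp [derT_apply]
  | succ k =>
    rw [map_sub, derT_apply, derT_apply, Fin.sum_univ_castSucc, Fin.sum_univ_succ (n := k),
      substT_zero_cycT, add_comm (rotT _ _), add_sub_add_comm, ← Finset.sum_sub_distrib]
    refine Submodule.add_mem _ (Submodule.sum_mem _ fun p _ => ?_) (sub_rotT_mem_cycSpan _ _)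
    rw [substT_succ_cycT]
    exact sub_rotT_mem_cycSpan _ _

theorem derT_mem_cycSpan {g n k l : ℕ} (h : n = k + l) (η : Tens g (l + 2)) {t : Tens g k}
    (ht : t ∈ cycSpan g k) : derT h η t ∈ cycSpan g n := by
  have hle : cycSpan g k ≤ (cycSpan g n).comap (derT h η) := by
    refine Submodule.span_le.2 ?_
    rintro _ ⟨v, rfl⟩
    exact derT_sub_cycT_mem h η v
  exact hle ht

/-! ## The contraction of a bracket -/

theorem cons_cons_apply {α : Type*} {n : ℕ} (c d : α) (w : Fin n → α) (i : Fin (n + 2)) :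
    (Fin.cons c (Fin.cons d w : Fin (n + 1) → α) : Fin (n + 2) → α) i =
      if i.val = 0 then c else if h : i.val < 2 then d
        else w ⟨i.val - 2, by have := i.isLt; omega⟩ := by
  refine Fin.cases ?_ (fun j => ?_) i
  · simp
  · refine Fin.cases ?_ (fun m => ?_) j <;> simp

theorem K12_sub {g m : ℕ} (s t : Tens g (m + 2)) : K12 (s - t) = K12 s - K12 t := by
  funext w
  simp only [K12, Pi.sub_apply, mul_sub, Finset.sum_sub_distrib]

theorem K12_add {g m : ℕ} (s t : Tens g (m + 2)) : K12 (s + t) = K12 s + K12 t := by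
  funext w
  simp only [K12, Pi.add_apply, mul_add, Finset.sum_add_distrib]

theorem K12_sum {g m : ℕ} {ι : Type*} (s : Finset ι) (f : ι → Tens g (m + 2)) :
    K12 (∑ i ∈ s, f i) = ∑ i ∈ s, K12 (f i) :=
  map_sum (⟨⟨K12, by funext w; simp [K12]⟩, K12_add⟩ : Tens g (m + 2) →+ Tens g m) f s

theorem sum_comm_pairs {ι : Type*} [Fintype ι] (F : ι → ι → ι → ι → ℚ) :
    ∑ c, ∑ d, ∑ a, ∑ b, F c d a b = ∑ a, ∑ b, ∑ c, ∑ d, F c d a b := by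
  have h : ∀ G : ι → ι → ℚ, ∑ i, ∑ j, G i j = ∑ x : ι × ι, G x.1 x.2 :=
    fun G => (Fintype.sum_prod_type' G).symm
  simp only [h]
  exact Finset.sum_comm

theorem sum_reverse {ι : Type*} [Fintype ι] (F : ι → ι → ι → ι → ℚ) :
    ∑ c, ∑ d, ∑ a, ∑ b, F c d a b = ∑ b, ∑ a, ∑ d, ∑ c, F c d a b := by
  rw [sum_comm_pairs, Finset.sum_comm]
  exact Finset.sum_congr rfl fun _ _ => Finset.sum_congr rfl fun _ _ => Finset.sum_comm

theorem K12_substT_succ_succ {g n k l : ℕ} (h : n = k + l) (h' : n + 2 = k + 2 + l)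
    (η : Tens g (l + 2)) (p : Fin k) (t : Tens g (k + 2)) :
    K12 (substT h' η p.succ.succ t) = substT h η p (K12 t) := by
  funext w
  have e : ∀ c d a b : Fin (2 * g),
      t (fun q => if q.val < p.succ.succ.val then
          (Fin.cons c (Fin.cons d w : Fin (n + 1) → _) : Fin (n + 2) → Fin (2 * g))
            ⟨q.val, by have := q.isLt; omega⟩
        else if q.val = p.succ.succ.val then a
        else (Fin.cons c (Fin.cons d w : Fin (n + 1) → _) : Fin (n + 2) → Fin (2 * g))
            ⟨q.val + l, by have := q.isLt; omega⟩) *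
      η (fun r => if r.val = 0 then b
        else (Fin.cons c (Fin.cons d w : Fin (n + 1) → _) : Fin (n + 2) → Fin (2 * g))
          ⟨p.succ.succ.val + r.val - 1, by have := p.isLt; have := r.isLt; simp; omega⟩) =
      t (Fin.cons c (Fin.cons d fun q => if q.val < p.val then w ⟨q.val, by have := q.isLt; omega⟩
        else if q.val = p.val then a
        else w ⟨q.val + l, by have := q.isLt; omega⟩)) *
      η (fun r => if r.val = 0 then b
        else w ⟨p.val + r.val - 1, by have := p.isLt; have := r.isLt; omega⟩) := by
    intro c d a b
    congr 1
    · congr 1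
      funext q
      simp only [cons_cons_apply, Fin.val_succ]
      split_ifs <;> first | rfl | omega | (congr 2; omega)
    · congr 1
      funext r
      simp only [cons_cons_apply, Fin.val_succ]
      split_ifs <;> first | rfl | omega | (congr 2; omega)
  simp only [K12, substT, mul_assoc, e, Finset.mul_sum, Finset.sum_mul]
  rw [sum_comm_pairs]
  exact Finset.sum_congr rfl fun a _ => Finset.sum_congr rfl fun b _ =>
    Finset.sum_congr rfl fun c _ => Finset.sum_congr rfl fun d _ => by ring

theorem K12_substT_one {g n k l : ℕ} (h : n = k + l) (h₁ : n + 2 = k + 2 + l)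
    (h₂ : n + 2 = l + 2 + k) (ξ : Tens g (k + 2)) (η : Tens g (l + 2)) :
    K12 (substT h₁ η 1 ξ) = rotT l (K12 (substT h₂ ξ 1 η)) := by
  funext w
  simp only [K12, rotT, substT, Finset.mul_sum]
  rw [sum_reverse]
  refine Finset.sum_congr rfl fun b _ => Finset.sum_congr rfl fun a _ =>
    Finset.sum_congr rfl fun d _ => Finset.sum_congr rfl fun c _ => ?_
  rw [omegaB_swap g a b, omegaB_swap g c d]
  have key : ∀ x x' y y' : ℚ, x = x' → y = y' →
      omegaB g c d * (omegaB g a b * x * y) = -omegaB g a b * (-omegaB g c d * y' * x') := by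
    rintro x _ y _ rfl rfl
    ring
  apply key
  · refine congrArg ξ (funext fun q => ?_)
    have hq := q.isLt
    simp only [cons_cons_apply, Fin.val_one]
    by_cases h0 : q.val = 0
    · simp [h0]
    by_cases h1 : q.val = 1
    · simp [h1]
    have e : (1 + q.val - 1 - 2 + l) % n = q.val + l - 2 := by
      rw [Nat.mod_eq_of_lt (by omega)]; omega
    simp only [e]
    split_ifs <;> first | rfl | omega
  · refine congrArg η (funext fun r => ?_)
    have hr := r.isLt
    simp only [cons_cons_apply, Fin.val_one]
    by_cases h2 : r.val < 2
    · split_ifs <;> first | rfl | omega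
    have e : (r.val + k - 2 + l) % n = 1 + r.val - 1 - 2 := by
      rw [show r.val + k - 2 + l = r.val - 2 + n by omega, Nat.add_mod_right,
        Nat.mod_eq_of_lt (by omega)]
      omega
    simp only [e]
    split_ifs <;> first | rfl | omega

theorem brT_eq {g k l : ℕ} (h₁ : k + l + 2 = k + 2 + l) (h₂ : k + l + 2 = l + 2 + k)
    (ξ : Tens g (k + 2)) (η : Tens g (l + 2)) :
    brT ξ η = ∑ p : Fin (k + 1), substT h₁ η p.succ ξ
      - ∑ p : Fin (l + 1), substT h₂ ξ p.succ η := by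
  funext w
  simp only [brT, Pi.sub_apply, Finset.sum_apply]
  rw [Fin.sum_univ_succ (n := k + 1), Fin.sum_univ_succ (n := l + 1)]
  simp only [Fin.val_zero, if_true, zero_add, Fin.val_succ, Nat.succ_ne_zero, if_false]
  congr 1
  exact Finset.sum_congr rfl fun p _ => Finset.sum_comm

theorem K12_brT {g k l : ℕ} (h : k + l = l + k)
    (ξ : Tens g (k + 2)) (η : Tens g (l + 2)) :
    ∃ s : Tens g (k + l),
      K12 (brT ξ η) = derT rfl η (K12 ξ) - derT h ξ (K12 η) - (s - rotT l s) := by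
  have h₁ : k + l + 2 = k + 2 + l := by omega
  have h₂ : k + l + 2 = l + 2 + k := by omega
  refine ⟨K12 (substT h₂ ξ 1 η), ?_⟩
  rw [brT_eq h₁ h₂, K12_sub, K12_sum, K12_sum, Fin.sum_univ_succ (n := k),
    Fin.sum_univ_succ (n := l), Fin.succ_zero_eq_one, Fin.succ_zero_eq_one,
    K12_substT_one rfl h₁ h₂, derT_apply, derT_apply]
  simp only [K12_substT_succ_succ rfl h₁, K12_substT_succ_succ h h₂]
  abel

/-- **Statement 15** (cf. Proposition 8.4): the kernel of the Enomoto–Satoh map is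
closed under the bracket of the symplectic derivation Lie algebra. -/
theorem ES_kernel_bracket_closed (g : ℕ) (hg : 1 ≤ g) (k l : ℕ) (hk : 1 ≤ k) (hl : 1 ≤ l)
    (ξ : Tens g (k+2)) (η : Tens g (l+2))
    (hξ : ξ ∈ hgl g k) (hη : η ∈ hgl g l)
    (hESξ : K12 ξ ∈ cycSpan g k) (hESη : K12 η ∈ cycSpan g l) :
    K12 (brT ξ η) ∈ cycSpan g (k+l) := by
  obtain ⟨s, hs⟩ := K12_brT (add_comm k l) ξ η
  rw [hs]
  exact Submodule.sub_mem _
    (Submodule.sub_mem _ (derT_mem_cycSpan _ _ hESξ) (derT_mem_cycSpan _ _ hESη))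
    (sub_rotT_mem_cycSpan l s)
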